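/- Let C, ν be real numbers, J(H) = H(H+1)(2H+1)/6, Φ_ν(H) = (J(H) + C + ν)/H, U(x) = (4x³ + 9x² + 5x)/6, and W(Δ) = U(Δ) − C. Let H* be the least positive integer with W(H*) ≥ ν (which exists since U is unbounded). Then Φ_ν(H*) ≤ Φ_ν(H) for all positive integers H; i.e., the optimal threshold policy transmits at the smallest age whose Whittle index is at least the subsidy. -/

import Mathlib

/-- Per-cycle cumulative staleness cost `J(H) = H(H+1)(2H+1)/6`. -/
noncomputable def J (H : ℕ) : ℝ := (H : ℝ) * ((H : ℝ) + 1) * (2 * (H : ℝ) + 1) / 6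

/-- Long-term average cost of the threshold-`H` policy with transmission cost `C`
and passivity subsidy `ν`. -/
noncomputable def Phi (C ν : ℝ) (H : ℕ) : ℝ := (J H + C + ν) / (H : ℝ)

/-- Cubic staleness urgency function `U(x) = (4x³ + 9x² + 5x)/6`. -/
noncomputable def U (x : ℝ) : ℝ := (4 * x ^ 3 + 9 * x ^ 2 + 5 * x) / 6

/-- Whittle index `W(Δ) = U(Δ) − C`. -/
noncomputable def W (C : ℝ) (Δ : ℕ) : ℝ := U (Δ : ℝ) - C

theorem Phi_succ_sub (C ν : ℝ) {n : ℕ} (hn : 0 < n) :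
    Phi C ν (n + 1) - Phi C ν n = (W C n - ν) / ((n : ℝ) * ((n : ℝ) + 1)) := by
  have h : (n : ℝ) ≠ 0 := by positivity
  have h' : (n : ℝ) + 1 ≠ 0 := by positivity
  unfold Phi J W U
  push_cast
  field_simp
  ring

theorem Phi_le_succ {C ν : ℝ} {n : ℕ} (hn : 0 < n) (h : ν ≤ W C n) :
    Phi C ν n ≤ Phi C ν (n + 1) := by
  rw [← sub_nonneg, Phi_succ_sub C ν hn]
  exact div_nonneg (sub_nonneg.2 h) (by positivity)

theorem Phi_succ_le {C ν : ℝ} {n : ℕ} (hn : 0 < n) (h : W C n ≤ ν) :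
    Phi C ν (n + 1) ≤ Phi C ν n := by
  rw [← sub_nonpos, Phi_succ_sub C ν hn]
  exact div_nonpos_of_nonpos_of_nonneg (sub_nonpos.2 h) (by positivity)

theorem W_mono (C : ℝ) : Monotone (W C) := by
  intro m n h
  unfold W U
  gcongr

/-- If `H*` is the least positive integer with `W(H*) ≥ ν`, then
`Φ_ν(H*) ≤ Φ_ν(H)` for every positive integer `H`: the optimal threshold policy
transmits at the smallest age whose Whittle index is at least the subsidy. -/
theorem threshold_optimal (C ν : ℝ) (Hstar : ℕ) (hpos : 0 < Hstar)
    (hW : ν ≤ W C Hstar)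
    (hleast : ∀ H : ℕ, 0 < H → H < Hstar → W C H < ν) :
    ∀ H : ℕ, 0 < H → Phi C ν Hstar ≤ Phi C ν H := by
  intro H hH
  rcases le_total Hstar H with h | h
  · induction H, h using Nat.le_induction with
    | base => exact le_rfl
    | succ n hn ih =>
      have hn0 : 0 < n := hpos.trans_le hn
      exact (ih hn0).trans (Phi_le_succ hn0 (hW.trans (W_mono C hn)))
  · exact Nat.decreasingInduction'
      (P := fun n => 0 < n → Phi C ν Hstar ≤ Phi C ν n)
      (fun n hlt _ ih hn => (ih n.succ_pos).trans (Phi_succ_le hn (hleast n hn hlt).le))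
      h (fun _ => le_rfl) hH
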